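/- There exists a Lebesgue-null set E ⊂ Y such that for every y₀ ∈ Y \ E: (i) the fixed-initialization switching set N(y₀) = { x ∈ K* : y₀ ∈ Σ°(x) } has d-dimensional Lebesgue measure zero; (ii) for every x ∈ K* \ N(y₀), the limit u(y₀, x) = lim_{t→∞} g^t(y₀, x) exists; and (iii) the map x ↦ u(y₀, x) is locally Lipschitz on K* \ N(y₀). -/

import Mathlib

open Filter Topology MeasureTheory Set Metric Bornology RealInnerProductSpace
open scoped ENNReal NNReal

noncomputable section

namespace Bif

abbrev Xs (d : ℕ) : Type := EuclideanSpace ℝ (Fin d)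
abbrev Ys (m : ℕ) : Type := EuclideanSpace ℝ (Fin m)
abbrev Zs (m d : ℕ) : Type := WithLp 2 (Ys m × Xs d)

variable {d m n : ℕ}

/-- The point `(y, x)` in `Y × ℝ^d` equipped with the product Euclidean (ℓ²) norm. -/
def ptYX (y : Ys m) (x : Xs d) : Zs m d := (WithLp.equiv 2 (Ys m × Xs d)).symm (y, x)

def projY (p : Zs m d) : Ys m := ((WithLp.equiv 2 (Ys m × Xs d)) p).1

def projX (p : Zs m d) : Xs d := ((WithLp.equiv 2 (Ys m × Xs d)) p).2

/-- `f` is locally Lipschitz on `s`: every point of `s` has a relative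
neighborhood on which `f` is Lipschitz. -/
def LocLipOn {α β : Type*} [PseudoEMetricSpace α] [PseudoEMetricSpace β]
    (s : Set α) (f : α → β) : Prop :=
  ∀ x ∈ s, ∃ C : NNReal, ∃ t ∈ 𝓝[s] x, LipschitzOnWith C f t

/-- The solution set `F(x) = {f_1(x), …, f_n(x)}`. -/
def Fset (f : Fin n → Xs d → Ys m) (x : Xs d) : Set (Ys m) :=
  Set.range fun i => f i x

/-- The reduced Voronoi switching set `Σ°(x)`. -/
def Sigma0 (f : Fin n → Xs d → Ys m) (x : Xs d) : Set (Ys m) :=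
  {y | ∃ i j : Fin n, f i x ≠ f j x ∧ ‖y - f i x‖ = ‖y - f j x‖ ∧
        ∀ k, ‖y - f i x‖ ≤ ‖y - f k x‖}

/-- The graph-closure switching set `Σ̃(x₀)`: the graph of `Σ̃` is the closure of
the graph of `Σ°` (over base points in `K`). -/
def SigmaTilde (K : Set (Xs d)) (f : Fin n → Xs d → Ys m) (x0 : Xs d) : Set (Ys m) :=
  {y | (x0, y) ∈ closure {p : Xs d × Ys m | p.1 ∈ K ∧ p.2 ∈ Sigma0 f p.1}}

/-- `x₀` has a stable collapse pattern: on a relative neighborhood `U ⊆ K` of `x₀`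
there is a partition (equivalence relation) of the branch indices such that two
branches agree at a point of `U` iff they lie in the same cluster. -/
def StableAt (K : Set (Xs d)) (f : Fin n → Xs d → Ys m) (x0 : Xs d) : Prop :=
  ∃ U ∈ 𝓝[K] x0, U ⊆ K ∧ ∃ R : Fin n → Fin n → Prop, Equivalence R ∧
    ∀ x ∈ U, ∀ i j : Fin n, (f i x = f j x ↔ R i j)

/-- The unstable collapse set `𝒰 = K \ S`. -/
def Unstable (K : Set (Xs d)) (f : Fin n → Xs d → Ys m) : Set (Xs d) :=
  {x ∈ K | ¬ StableAt K f x}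

/-- `P` is the priority nearest selector: `P y x = f i x` where `i` is the
smallest index minimizing `‖y - f i x‖`. -/
def IsPrioritySelector (f : Fin n → Xs d → Ys m) (P : Ys m → Xs d → Ys m) : Prop :=
  ∀ (y : Ys m) (x : Xs d), ∃ i : Fin n, P y x = f i x ∧
    (∀ j, ‖y - f i x‖ ≤ ‖y - f j x‖) ∧
    (∀ j, (∀ k, ‖y - f j x‖ ≤ ‖y - f k x‖) → i ≤ j)

/-- On `closure K \ K`, `f` takes the value of the limit of `f` along `K` when this
limit exists, and `0` otherwise (limit-or-zero extension of the branch maps). -/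
def IsLimitExtension (K : Set (Xs d)) (f : Fin n → Xs d → Ys m) : Prop :=
  ∀ i : Fin n, ∀ x ∈ closure K \ K,
    Tendsto (f i) (𝓝[K] x) (𝓝 (f i x)) ∨
    ((¬ ∃ L : Ys m, Tendsto (f i) (𝓝[K] x) (𝓝 L)) ∧ f i x = 0)

/-- `𝒟`: the points of `closure K` at which some (extended) branch fails to be
locally Lipschitz. -/
def DSet (K : Set (Xs d)) (f : Fin n → Xs d → Ys m) : Set (Xs d) :=
  {x ∈ closure K | ∃ i : Fin n,
    ¬ ∃ C : NNReal, ∃ t ∈ 𝓝[closure K] x, LipschitzOnWith C (f i) t}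

/-- The joint bad set `ℬ ⊆ Y × closure K`. -/
def BadSet (K : Set (Xs d)) (f : Fin n → Xs d → Ys m) : Set (Zs m d) :=
  {p | projX p ∈ DSet K f ∪ closure (Unstable K f) ∨ projY p ∈ SigmaTilde K f (projX p)}

/-- `ρ(y, x) = dist((y, x), ℬ)` in the product Euclidean norm. -/
def rhoB (K : Set (Xs d)) (f : Fin n → Xs d → Ys m) (y : Ys m) (x : Xs d) : ℝ :=
  Metric.infDist (ptYX y x) (BadSet K f)

/-- `ω(y, x) = ρ(y, x) / (1 + ρ(y, x))`. -/
def omegaB (K : Set (Xs d)) (f : Fin n → Xs d → Ys m) (y : Ys m) (x : Xs d) : ℝ :=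
  rhoB K f y x / (1 + rhoB K f y x)

/-- The safe tube `𝒮(R, s)`. -/
def STube (K : Set (Xs d)) (f : Fin n → Xs d → Ys m) (R s : ℝ) : Set (Ys m × Xs d) :=
  {q | q.2 ∈ closure K ∧ ‖q.1‖ ≤ R ∧ s ≤ omegaB K f q.1 q.2}

/-- The set whose supremum is the safe-set profile `H₁(R, s)`. -/
def H1set (K : Set (Xs d)) (f : Fin n → Xs d → Ys m) (P : Ys m → Xs d → Ys m)
    (R s : ℝ) : Set ℝ :=
  {r | ∃ y x z, (y, x) ∈ STube K f R s ∧ (y, z) ∈ STube K f R s ∧ x ≠ z ∧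
       r = ‖P y x - P y z‖ / ‖x - z‖}

/-- The set whose supremum is the safe-set profile `H₂(R, s)`. -/
def H2set (K : Set (Xs d)) (f : Fin n → Xs d → Ys m) (P : Ys m → Xs d → Ys m)
    (R s : ℝ) : Set ℝ :=
  {r | ∃ y x, (y, x) ∈ STube K f R s ∧ r = ‖P y x‖}

def H1 (K : Set (Xs d)) (f : Fin n → Xs d → Ys m) (P : Ys m → Xs d → Ys m) (R s : ℝ) : ℝ :=
  sSup (H1set K f P R s)

def H2 (K : Set (Xs d)) (f : Fin n → Xs d → Ys m) (P : Ys m → Xs d → Ys m) (R s : ℝ) : ℝ :=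
  sSup (H2set K f P R s)

/-- `λ_R(s) = 1 / (H₁(R, s) + H₂(R, s) + 1)`. -/
def lamB (K : Set (Xs d)) (f : Fin n → Xs d → Ys m) (P : Ys m → Xs d → Ys m)
    (R s : ℝ) : ℝ :=
  1 / (H1 K f P R s + H2 K f P R s + 1)

/-- `Θ_R(r) = ∫₀^r λ_R(s) ds`. -/
def ThetaB (K : Set (Xs d)) (f : Fin n → Xs d → Ys m) (P : Ys m → Xs d → Ys m)
    (R r : ℝ) : ℝ :=
  ∫ s in (0:ℝ)..r, lamB K f P R s

/-- The damping factor `η(y, x)`. -/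
def etaB (K : Set (Xs d)) (f : Fin n → Xs d → Ys m) (P : Ys m → Xs d → Ys m)
    (y : Ys m) (x : Xs d) : ℝ :=
  ThetaB K f P (1 + ‖y‖) (omegaB K f y x) /
    (1 + ThetaB K f P (1 + ‖y‖) (omegaB K f y x))

/-- The recurrent operator `g(y, x) = (1 − η(y, x)) y + η(y, x) P_y(x)`. -/
def gB (K : Set (Xs d)) (f : Fin n → Xs d → Ys m) (P : Ys m → Xs d → Ys m)
    (y : Ys m) (x : Xs d) : Ys m :=
  (1 - etaB K f P y x) • y + etaB K f P y x • P y x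

lemma ptYX_cont : Continuous fun q : Ys m × Xs d => ptYX q.1 q.2 :=
  WithLp.prod_continuous_toLp 2 (Ys m) (Xs d)

lemma projX_cont : Continuous (projX : Zs m d → Xs d) :=
  (WithLp.prod_continuous_ofLp 2 (Ys m) (Xs d)).snd

lemma projY_cont : Continuous (projY : Zs m d → Ys m) :=
  (WithLp.prod_continuous_ofLp 2 (Ys m) (Xs d)).fst

lemma mem_bad {K : Set (Xs d)} {f : Fin n → Xs d → Ys m} {y : Ys m} {x : Xs d} :
    ptYX y x ∈ BadSet K f ↔
      x ∈ DSet K f ∪ closure (Unstable K f) ∨ y ∈ SigmaTilde K f x := Iff.rfl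

lemma DSet_closed (K : Set (Xs d)) (f : Fin n → Xs d → Ys m) : IsClosed (DSet K f) := by
  rw [← isOpen_compl_iff, isOpen_iff_mem_nhds]
  intro x hx
  by_cases hxK : x ∈ closure K
  · have h : ∀ i, ∃ C : NNReal, ∃ t ∈ 𝓝[closure K] x, LipschitzOnWith C (f i) t := by
      by_contra hc
      exact hx ⟨hxK, by push Not at hc ⊢; exact hc⟩
    have h2 : ∀ᶠ z in 𝓝[closure K] x, ∀ i, ∃ C : NNReal, ∃ t ∈ 𝓝[closure K] z,
        LipschitzOnWith C (f i) t := by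
      rw [eventually_all]
      intro i
      obtain ⟨C, t, ht, hL⟩ := h i
      have : ∀ᶠ z in 𝓝[closure K] x, t ∈ 𝓝[closure K] z :=
        eventually_eventually_nhdsWithin.2 ht
      filter_upwards [this] with z hz using ⟨C, t, hz, hL⟩
    rw [eventually_nhdsWithin_iff] at h2
    filter_upwards [h2] with z hz hzD
    obtain ⟨hzK, i, hi⟩ := hzD
    exact hi (hz hzK i)
  · filter_upwards [isClosed_closure.isOpen_compl.mem_nhds hxK] with z hz hzD
    exact hz hzD.1

lemma Bad_closed (K : Set (Xs d)) (f : Fin n → Xs d → Ys m) : IsClosed (BadSet K f) := by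
  apply IsClosed.union
  · exact ((DSet_closed K f).union isClosed_closure).preimage projX_cont
  · exact isClosed_closure.preimage (projX_cont.prodMk projY_cont)

lemma contOn {K : Set (Xs d)} {f : Fin n → Xs d → Ys m} (hf : ∀ i, LocLipOn K (f i))
    (i : Fin n) : ContinuousOn (f i) K := by
  intro x hx
  obtain ⟨C, t, ht, hL⟩ := hf i x hx
  have hxt : x ∈ t := mem_of_mem_nhdsWithin hx ht
  exact (hL.continuousOn x hxt).mono_of_mem_nhdsWithin ht

lemma notD {K : Set (Xs d)} {f : Fin n → Xs d → Ys m} (hf : ∀ i, LocLipOn K (f i))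
    (hext : IsLimitExtension K f) {x : Xs d} (hx : x ∈ K) : x ∉ DSet K f := by
  rintro ⟨-, i, hi⟩
  apply hi
  obtain ⟨C, t, ht, hL⟩ := hf i x hx
  obtain ⟨g, hg, hgt⟩ := hL.extend_finite_dimension
  obtain ⟨ε, hε, hεt⟩ := Metric.mem_nhdsWithin_iff.1 ht
  refine ⟨lipschitzExtensionConstant (Ys m) * C, closure K ∩ ball x ε, inter_mem self_mem_nhdsWithin
    (mem_nhdsWithin_of_mem_nhds (ball_mem_nhds x hε)), ?_⟩
  suffices heq : ∀ z ∈ closure K ∩ ball x ε, f i z = g z by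
    intro a ha b hb
    rw [heq a ha, heq b hb]
    exact hg a b
  rintro z ⟨hzK, hz⟩
  by_cases hzK' : z ∈ K
  · exact hgt (hεt ⟨hz, hzK'⟩)
  · have hT : Tendsto (f i) (𝓝[K] z) (𝓝 (g z)) := by
      have h1 : Tendsto g (𝓝[K] z) (𝓝 (g z)) :=
        hg.continuous.continuousAt.mono_left nhdsWithin_le_nhds
      refine h1.congr' ?_
      filter_upwards [self_mem_nhdsWithin,
        mem_nhdsWithin_of_mem_nhds (isOpen_ball.mem_nhds hz)] with w hw hw2
      exact (hgt (hεt ⟨hw2, hw⟩)).symm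
    have : (𝓝[K] z).NeBot := mem_closure_iff_nhdsWithin_neBot.1 hzK
    rcases hext i z ⟨hzK, hzK'⟩ with h | h
    · exact tendsto_nhds_unique h hT
    · exact absurd ⟨_, hT⟩ h.1

lemma notUnst {K : Set (Xs d)} {f : Fin n → Xs d → Ys m} {x : Xs d}
    (hx : x ∈ K \ Unstable K f) : x ∉ closure (Unstable K f) := by
  have hs : StableAt K f x := by
    by_contra h
    exact hx.2 ⟨hx.1, h⟩
  obtain ⟨U, hU, hUK, R, hR, hfR⟩ := hs
  have h : ∀ᶠ z in 𝓝[K] x, U ∈ 𝓝[K] z := eventually_eventually_nhdsWithin.2 hU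
  rw [eventually_nhdsWithin_iff] at h
  rw [mem_closure_iff_frequently, not_frequently]
  filter_upwards [h] with z hz hzU
  exact hzU.2 ⟨U, hz hzU.1, hUK, R, hR, hfR⟩

lemma notTilde {K : Set (Xs d)} {f : Fin n → Xs d → Ys m} (hf : ∀ i, LocLipOn K (f i))
    {x : Xs d} (hx : x ∈ K \ Unstable K f) {y : Ys m} (hy : y ∉ Sigma0 f x) :
    y ∉ SigmaTilde K f x := by
  have hs : StableAt K f x := by
    by_contra h
    exact hx.2 ⟨hx.1, h⟩
  obtain ⟨U, hU, hUK, R, hR, hfR⟩ := hs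
  have hxU : x ∈ U := mem_of_mem_nhdsWithin hx.1 hU
  intro hc
  change (x, y) ∈ closure _ at hc
  rw [mem_closure_iff_frequently] at hc
  apply hc
  have hfst : Tendsto (Prod.fst : Xs d × Ys m → Xs d) (𝓝[K ×ˢ univ] (x, y)) (𝓝[K] x) := by
    refine tendsto_nhdsWithin_iff.2 ⟨continuous_fst.continuousAt.mono_left nhdsWithin_le_nhds, ?_⟩
    filter_upwards [self_mem_nhdsWithin] with p hp using hp.1
  have hsnd : Tendsto (Prod.snd : Xs d × Ys m → Ys m) (𝓝[K ×ˢ univ] (x, y)) (𝓝 y) :=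
    continuous_snd.continuousAt.mono_left nhdsWithin_le_nhds
  have hfi : ∀ i, Tendsto (fun p : Xs d × Ys m => ‖p.2 - f i p.1‖) (𝓝[K ×ˢ univ] (x, y))
      (𝓝 ‖y - f i x‖) := fun i =>
    (hsnd.sub ((contOn hf i x hx.1).tendsto.comp hfst)).norm
  have main : ∀ᶠ p in 𝓝[K ×ˢ univ] (x, y), ∀ i j : Fin n,
      ¬ (f i p.1 ≠ f j p.1 ∧ ‖p.2 - f i p.1‖ = ‖p.2 - f j p.1‖ ∧
        ∀ k, ‖p.2 - f i p.1‖ ≤ ‖p.2 - f k p.1‖) := by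
    rw [eventually_all]; intro i
    rw [eventually_all]; intro j
    by_cases hij : f i x = f j x
    · filter_upwards [hfst.eventually hU] with p hp hp2
      exact hp2.1 ((hfR _ hp i j).2 ((hfR _ hxU i j).1 hij))
    by_cases he : ‖y - f i x‖ = ‖y - f j x‖
    · have : ∃ k, ‖y - f k x‖ < ‖y - f i x‖ := by
        by_contra hk
        push Not at hk
        exact hy ⟨i, j, hij, he, hk⟩
      obtain ⟨k, hk⟩ := this
      filter_upwards [(hfi k).eventually_lt (hfi i) hk] with p hp hp2
      exact absurd (hp2.2.2 k) (not_le.2 hp)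
    · filter_upwards [((hfi i).prodMk_nhds (hfi j)).eventually
        ((isOpen_ne_fun continuous_fst continuous_snd).mem_nhds he)] with p hp hp2
      exact hp hp2.2.1
  rw [eventually_nhdsWithin_iff] at main
  filter_upwards [main] with p hp hp2
  obtain ⟨i, j, h⟩ := hp2.2
  exact hp ⟨hp2.1, trivial⟩ i j h

lemma notBad {K : Set (Xs d)} {f : Fin n → Xs d → Ys m} (hf : ∀ i, LocLipOn K (f i))
    (hext : IsLimitExtension K f)
    {x : Xs d} (hx : x ∈ K \ Unstable K f) {y : Ys m} (hy : y ∉ Sigma0 f x) :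
    ptYX y x ∉ BadSet K f := by
  rw [mem_bad]
  rintro ((h | h) | h)
  · exact notD hf hext hx.1 h
  · exact notUnst hx h
  · exact notTilde hf hx hy h

lemma key_ineq {y a b : Ys m} {r : ℝ} (hr : 0 < r)
    (h : ∀ w ∈ ball y r, ‖w - a‖ ≤ ‖w - b‖) : r * ‖b - a‖ ≤ ‖y - b‖ ^ 2 - ‖y - a‖ ^ 2 := by
  by_cases hv : b - a = 0
  · have : b = a := sub_eq_zero.1 hv
    simp [this]
  have hv' : 0 < ‖b - a‖ := norm_pos_iff.2 hv
  have h1 := h (y + (r / 2 / ‖b - a‖) • (b - a)) (by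
    rw [mem_ball, dist_eq_norm, add_sub_cancel_left, norm_smul, Real.norm_of_nonneg (by positivity)]
    field_simp
    linarith)
  have h2 : ‖y + (r / 2 / ‖b - a‖) • (b - a) - a‖ ^ 2 ≤ ‖y + (r / 2 / ‖b - a‖) • (b - a) - b‖ ^ 2 := by
    gcongr
  have e1 : y + (r / 2 / ‖b - a‖) • (b - a) - a = (y - a) + (r / 2 / ‖b - a‖) • (b - a) := by abel
  have e2 : y + (r / 2 / ‖b - a‖) • (b - a) - b = (y - b) + (r / 2 / ‖b - a‖) • (b - a) := by abel
  rw [e1, e2, norm_add_sq_real, norm_add_sq_real, inner_smul_right, inner_smul_right] at h2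
  have e3 : (inner ℝ (y - a) (b - a) : ℝ) - (inner ℝ (y - b) (b - a) : ℝ) = ‖b - a‖ ^ 2 := by
    rw [← inner_sub_left, ← real_inner_self_eq_norm_sq]
    congr 1; abel
  have e4 : 2 * (r / 2 / ‖b - a‖ * (inner ℝ (y - a) (b - a) : ℝ)) - 2 * (r / 2 / ‖b - a‖ * (inner ℝ (y - b) (b - a) : ℝ))
      = r * ‖b - a‖ := by
    have : (inner ℝ (y - a) (b - a) : ℝ) = (inner ℝ (y - b) (b - a) : ℝ) + ‖b - a‖ ^ 2 := by linarith
    rw [this]; field_simp; ring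
  linarith

lemma local_lemma {K : Set (Xs d)} {f : Fin n → Xs d → Ys m} {P : Ys m → Xs d → Ys m}
    (hP : IsPrioritySelector f P) {y : Ys m} {x : Xs d}
    (hx : x ∈ closure K) (hb : ptYX y x ∉ BadSet K f) :
    ∃ r > 0, ∃ C M : ℝ, 0 ≤ C ∧ 0 ≤ M ∧
      (∀ w ∈ ball y r, ∀ a ∈ closure K ∩ ball x r, ‖P w a‖ ≤ M) ∧
      (∀ w ∈ ball y r, ∀ a ∈ closure K ∩ ball x r, ∀ b ∈ closure K ∩ ball x r,
        ‖P w a - P w b‖ ≤ C * ‖a - b‖) := by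
  have hxD : x ∉ DSet K f := fun h => hb (mem_bad.2 (Or.inl (Or.inl h)))
  have hl : ∀ i, ∃ C : NNReal, ∃ t ∈ 𝓝[closure K] x, LipschitzOnWith C (f i) t := by
    by_contra hc
    exact hxD ⟨hx, by push Not at hc ⊢; exact hc⟩
  choose C t ht hL using hl
  have h1 : ∀ᶠ q : Ys m × Xs d in 𝓝 (y, x), ptYX q.1 q.2 ∉ BadSet K f :=
    ((Bad_closed K f).preimage ptYX_cont).isOpen_compl.mem_nhds hb
  obtain ⟨r1, hr1, h1⟩ := Metric.eventually_nhds_iff_ball.1 h1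
  obtain ⟨r2, hr2, h2⟩ := Metric.mem_nhdsWithin_iff.1 (iInter_mem.2 ht)
  set L : ℝ := ∑ i, (C i : ℝ) with hLdef
  have hL0 : 0 ≤ L := Finset.sum_nonneg fun i _ => (C i).2
  obtain ⟨r, hr, hrr1, hrr2⟩ : ∃ r > 0, r ≤ r1 ∧ r ≤ r2 :=
    ⟨min r1 r2, lt_min hr1 hr2, min_le_left _ _, min_le_right _ _⟩
  have lip : ∀ i, ∀ a ∈ closure K ∩ ball x r, ∀ b ∈ closure K ∩ ball x r,
      ‖f i a - f i b‖ ≤ L * ‖a - b‖ := by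
    intro i a ha b hb
    have hm : ∀ a ∈ closure K ∩ ball x r, a ∈ t i := fun a ha =>
      mem_iInter.1 (h2 ⟨ball_subset_ball hrr2 ha.2, ha.1⟩) i
    have := (hL i).dist_le_mul a (hm a ha) b (hm b hb)
    rw [dist_eq_norm, dist_eq_norm] at this
    refine this.trans ?_
    gcongr
    exact Finset.single_le_sum (f := fun i => (C i : ℝ)) (fun i _ => (C i).2) (Finset.mem_univ i)
  have nosig : ∀ w ∈ ball y r, ∀ a ∈ K ∩ ball x r, w ∉ Sigma0 f a := by
    intro w hw a ha hs
    refine h1 (w, a) ?_ (mem_bad.2 (Or.inr (subset_closure ⟨ha.1, hs⟩)))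
    rw [← ball_prod_same]
    exact ⟨ball_subset_ball hrr1 hw, ball_subset_ball hrr1 ha.2⟩
  have cont : ∀ i, ∀ a ∈ closure K ∩ ball x r, ContinuousWithinAt (f i) (closure K) a := by
    intro i a ha
    have hlo : LipschitzOnWith L.toNNReal (f i) (closure K ∩ ball x r) :=
      LipschitzOnWith.of_dist_le_mul fun a ha b hb => by
        rw [dist_eq_norm, dist_eq_norm, Real.coe_toNNReal _ hL0]
        exact lip i a ha b hb
    refine (hlo.continuousOn a ha).mono_of_mem_nhdsWithin ?_
    exact inter_mem self_mem_nhdsWithin (mem_nhdsWithin_of_mem_nhds (isOpen_ball.mem_nhds ha.2))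
  have goodK : ∀ a ∈ K ∩ ball x r, ∃ i, ∀ w ∈ ball y r, ∀ k, ‖w - f i a‖ ≤ ‖w - f k a‖ := by
    intro a ha
    obtain ⟨i, -, hi, -⟩ := hP y a
    refine ⟨i, ?_⟩
    by_contra hcon
    push Not at hcon
    obtain ⟨w0, hw0, k, hk⟩ := hcon
    have hcell : ∀ i, IsClosed {w : Ys m | ∀ k, ‖w - f i a‖ ≤ ‖w - f k a‖} := by
      intro i
      simp only [ofPred_forall]
      exact isClosed_iInter fun k => isClosed_le (by fun_prop) (by fun_prop)
    have hcl2 : IsClosed (⋃ j : {j // f j a ≠ f i a},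
        {w : Ys m | ∀ k, ‖w - f j a‖ ≤ ‖w - f k a‖}) :=
      isClosed_iUnion_of_finite fun j => hcell j
    have hpre := isPreconnected_closed_iff.1 (convex_ball y r).isPreconnected _ _ (hcell i) hcl2
      (by
        intro w _
        obtain ⟨j, -, hj, -⟩ := hP w a
        by_cases hji : f j a = f i a
        · left
          intro k
          rw [← hji]; exact hj k
        · right
          exact mem_iUnion.2 ⟨⟨j, hji⟩, hj⟩)
      ⟨y, mem_ball_self hr, hi⟩
      (by
        obtain ⟨j, -, hj, -⟩ := hP w0 a
        refine ⟨w0, hw0, mem_iUnion.2 ⟨⟨j, ?_⟩, hj⟩⟩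
        intro hji
        have := hj k
        rw [hji] at this
        exact absurd this (not_le.2 hk))
    obtain ⟨w, hw, hwi, hwj⟩ := hpre
    obtain ⟨⟨j, hj⟩, hwj⟩ := mem_iUnion.1 hwj
    exact nosig w hw a ha ⟨i, j, hj.symm, le_antisymm (hwi j) (hwj i), hwi⟩
  have good : ∀ a ∈ closure K ∩ ball x r, ∃ i, ∀ w ∈ ball y r, ∀ k,
      ‖w - f i a‖ ≤ ‖w - f k a‖ := by
    intro a ha
    by_contra hcon
    push Not at hcon
    choose w hw k hk using hcon
    have : (𝓝[K] a).NeBot := mem_closure_iff_nhdsWithin_neBot.1 ha.1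
    have hc : ∀ i, Tendsto (f i) (𝓝[K] a) (𝓝 (f i a)) := fun i =>
      ((cont i a ha).mono subset_closure).tendsto
    have hev : ∀ᶠ z in 𝓝[K] a, ∀ i, ‖w i - f (k i) z‖ < ‖w i - f i z‖ := by
      rw [eventually_all]
      intro i
      exact (tendsto_const_nhds.sub (hc (k i))).norm.eventually_lt
        (tendsto_const_nhds.sub (hc i)).norm (hk i)
    obtain ⟨z, hz, hzK, hzb⟩ := (hev.and (Filter.Eventually.and self_mem_nhdsWithin
      (mem_nhdsWithin_of_mem_nhds (isOpen_ball.mem_nhds ha.2)))).exists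
    obtain ⟨i, hi⟩ := goodK z ⟨hzK, hzb⟩
    exact absurd (hi (w i) (hw i) (k i)) (not_le.2 (hz i))
  have goodP : ∀ w ∈ ball y r, ∀ a ∈ closure K ∩ ball x r, ∃ i, P w a = f i a ∧
      ∀ w ∈ ball y r, ∀ k, ‖w - f i a‖ ≤ ‖w - f k a‖ := by
    intro w hw a ha
    obtain ⟨i, hi⟩ := good a ha
    refine ⟨i, ?_, hi⟩
    obtain ⟨j, hPj, hj, -⟩ := hP w a
    rw [hPj]
    have he : ‖w - f i a‖ = ‖w - f j a‖ := le_antisymm (hi w hw j) (hj i)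
    have hr' : 0 < r - dist w y := sub_pos.2 hw
    have := key_ineq (y := w) (a := f i a) (b := f j a) hr' (fun v hv => by
      refine hi v ?_ j
      rw [mem_ball] at hv ⊢
      have := dist_triangle v w y
      linarith)
    rw [he, sub_self] at this
    have h0 : ‖f j a - f i a‖ ≤ 0 := by
      by_contra h
      push Not at h
      have := mul_pos hr' h
      linarith
    exact sub_eq_zero.1 (norm_le_zero_iff.1 h0)
  have hxr : x ∈ closure K ∩ ball x r := ⟨hx, mem_ball_self hr⟩
  set M : ℝ := ∑ i, ‖f i x‖ + L * r with hM
  have hM0 : 0 ≤ M := add_nonneg (Finset.sum_nonneg fun i _ => norm_nonneg _) (by positivity)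
  have hMb : ∀ i, ∀ a ∈ closure K ∩ ball x r, ‖f i a‖ ≤ M := by
    intro i a ha
    have h1 := lip i a ha x hxr
    have h2 : ‖f i x‖ ≤ ∑ i, ‖f i x‖ :=
      Finset.single_le_sum (f := fun i => ‖f i x‖) (fun i _ => norm_nonneg _) (Finset.mem_univ i)
    have h3 : ‖a - x‖ ≤ r := by rw [← dist_eq_norm]; exact (mem_ball.1 ha.2).le
    have h4 : L * ‖a - x‖ ≤ L * r := by gcongr
    have h5 := norm_le_norm_add_norm_sub' (f i a) (f i x)
    linarith
  set N : ℝ := ‖y‖ + M with hN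
  have hNb : ∀ i, ∀ a ∈ closure K ∩ ball x r, ‖y - f i a‖ ≤ N := by
    intro i a ha
    exact (norm_sub_le _ _).trans (add_le_add le_rfl (hMb i a ha))
  have hN0 : 0 ≤ N := by positivity
  have sqd : ∀ i, ∀ a ∈ closure K ∩ ball x r, ∀ b ∈ closure K ∩ ball x r,
      ‖y - f i a‖ ^ 2 - ‖y - f i b‖ ^ 2 ≤ 2 * N * (L * ‖a - b‖) := by
    intro i a ha b hb
    have e : ‖y - f i a‖ ^ 2 - ‖y - f i b‖ ^ 2 =
      (‖y - f i a‖ + ‖y - f i b‖) * (‖y - f i a‖ - ‖y - f i b‖) := by ring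
    rw [e]
    have h1 : ‖y - f i a‖ - ‖y - f i b‖ ≤ L * ‖a - b‖ := by
      refine (norm_sub_norm_le _ _).trans ?_
      rw [sub_sub_sub_cancel_left, norm_sub_rev]
      exact lip i a ha b hb
    have h2 : ‖y - f i a‖ + ‖y - f i b‖ ≤ 2 * N := by
      have := hNb i a ha
      have := hNb i b hb
      linarith
    have h3 : 0 ≤ ‖y - f i a‖ + ‖y - f i b‖ := by positivity
    calc _ ≤ (‖y - f i a‖ + ‖y - f i b‖) * (L * ‖a - b‖) := by gcongr
      _ ≤ _ := by gcongr
  refine ⟨r, hr, 4 * N * L / r + L, M, by positivity, hM0, ?_, ?_⟩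
  · intro w hw a ha
    obtain ⟨i, hi, -⟩ := goodP w hw a ha
    rw [hi]; exact hMb i a ha
  · intro w hw a ha b hb
    obtain ⟨i, hi, gi⟩ := goodP w hw a ha
    obtain ⟨j, hj, gj⟩ := goodP w hw b hb
    rw [hi, hj]
    have k1 := key_ineq (y := y) (a := f i a) (b := f j a) hr (fun v hv => gi v hv j)
    have k2 := key_ineq (y := y) (a := f j b) (b := f i b) hr (fun v hv => gj v hv i)
    have s1 := sqd j a ha b hb
    have s2 := sqd i b hb a ha
    rw [norm_sub_rev b a] at s2
    have k3 : 0 ≤ r * ‖f i b - f j b‖ := by positivity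
    have k4 : ‖f j a - f i a‖ ≤ 4 * N * L / r * ‖a - b‖ := by
      rw [div_mul_eq_mul_div, le_div_iff₀ hr]
      linarith
    have k5 : ‖f i a - f j b‖ ≤ ‖f i a - f j a‖ + ‖f j a - f j b‖ := norm_sub_le_norm_sub_add_norm_sub _ _ _
    rw [norm_sub_rev (f i a) (f j a)] at k5
    have k6 := lip j a ha b hb
    rw [add_mul]
    linarith

section tube
variable {K : Set (Xs d)} {f : Fin n → Xs d → Ys m} {P : Ys m → Xs d → Ys m}

lemma rho_nonneg (y : Ys m) (x : Xs d) : 0 ≤ rhoB K f y x := infDist_nonneg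

lemma omega_nonneg (y : Ys m) (x : Xs d) : 0 ≤ omegaB K f y x :=
  div_nonneg (rho_nonneg y x) (add_nonneg zero_le_one (rho_nonneg y x))

lemma rho_cont : Continuous fun q : Ys m × Xs d => rhoB K f q.1 q.2 :=
  (continuous_infDist_pt _).comp ptYX_cont

lemma omega_cont : Continuous fun q : Ys m × Xs d => omegaB K f q.1 q.2 := by
  refine rho_cont.div (continuous_const.add rho_cont) fun q => ?_
  have := rho_nonneg (K := K) (f := f) q.1 q.2
  positivity

lemma notBad_of_omega {y : Ys m} {x : Xs d} (h : 0 < omegaB K f y x) :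
    ptYX y x ∉ BadSet K f := by
  intro hb
  have : rhoB K f y x = 0 := infDist_zero_of_mem hb
  simp [omegaB, this] at h

lemma tube_compact (hK : IsBounded K) (R s : ℝ) : IsCompact (STube K f R s) := by
  have hsub : STube K f R s ⊆ closedBall (0 : Ys m) R ×ˢ closure K := by
    rintro ⟨y, x⟩ ⟨h1, h2, h3⟩
    exact ⟨by simpa using h2, h1⟩
  have hc : IsCompact (closedBall (0 : Ys m) R ×ˢ closure K) :=
    (isCompact_closedBall _ _).prod hK.isCompact_closure
  refine hc.of_isClosed_subset ?_ hsub
  refine (isClosed_closure.preimage continuous_snd).inter (IsClosed.inter ?_ ?_)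
  · exact isClosed_le (continuous_norm.comp continuous_fst) continuous_const
  · exact isClosed_le continuous_const omega_cont

lemma bound2 (hK : IsBounded K) (hP : IsPrioritySelector f P)
    (R : ℝ) {s : ℝ} (hs : 0 < s) :
    ∃ M : ℝ, 0 ≤ M ∧ ∀ q ∈ STube K f R s, ‖P q.1 q.2‖ ≤ M := by
  refine (tube_compact hK R s).induction_on
    (p := fun S => ∃ M : ℝ, 0 ≤ M ∧ ∀ q ∈ S, ‖P q.1 q.2‖ ≤ M) ⟨0, le_rfl, by simp⟩ ?_ ?_ ?_
  · rintro S T hST ⟨M, h0, h⟩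
    exact ⟨M, h0, fun q hq => h q (hST hq)⟩
  · rintro S T ⟨M, h0, h⟩ ⟨M', h0', h'⟩
    refine ⟨max M M', le_max_of_le_left h0, ?_⟩
    rintro q (hq | hq)
    · exact (h q hq).trans (le_max_left _ _)
    · exact (h' q hq).trans (le_max_right _ _)
  · rintro ⟨y, x⟩ ⟨h1, h2, h3⟩
    obtain ⟨r, hr, C, M, hC, hM, hb, -⟩ := local_lemma hP h1
      (notBad_of_omega (lt_of_lt_of_le hs h3))
    refine ⟨STube K f R s ∩ (ball y r ×ˢ ball x r), inter_mem self_mem_nhdsWithin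
      (mem_nhdsWithin_of_mem_nhds (prod_mem_nhds (ball_mem_nhds _ hr) (ball_mem_nhds _ hr))),
      M, hM, ?_⟩
    rintro ⟨w, a⟩ ⟨hq, hw, ha⟩
    exact hb w hw a ⟨hq.1, ha⟩

lemma bound1 (hK : IsBounded K) (hP : IsPrioritySelector f P)
    (R : ℝ) {s : ℝ} (hs : 0 < s) :
    ∃ C : ℝ, 0 ≤ C ∧ ∀ y x z, (y, x) ∈ STube K f R s → (y, z) ∈ STube K f R s →
      ‖P y x - P y z‖ ≤ C * ‖x - z‖ := by
  obtain ⟨M, hM0, hM⟩ := bound2 hK hP R hs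
  set T : Set (Ys m × Xs d × Xs d) :=
    {q | (q.1, q.2.1) ∈ STube K f R s ∧ (q.1, q.2.2) ∈ STube K f R s} with hT
  have hTc : IsCompact T := by
    have hc : IsCompact (closedBall (0 : Ys m) R ×ˢ (closure K ×ˢ closure K)) :=
      (isCompact_closedBall _ _).prod (hK.isCompact_closure.prod hK.isCompact_closure)
    refine hc.of_isClosed_subset ?_ ?_
    · exact ((tube_compact hK R s).isClosed.preimage (by fun_prop)).inter
        ((tube_compact hK R s).isClosed.preimage (by fun_prop))
    · rintro ⟨y, x, z⟩ ⟨h1, h2⟩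
      exact ⟨by simpa using h1.2.1, h1.1, h2.1⟩
  have main : ∃ C : ℝ, 0 ≤ C ∧ ∀ q ∈ T, ‖P q.1 q.2.1 - P q.1 q.2.2‖ ≤ C * ‖q.2.1 - q.2.2‖ := by
    refine hTc.induction_on
      (p := fun S => ∃ C : ℝ, 0 ≤ C ∧ ∀ q ∈ S, ‖P q.1 q.2.1 - P q.1 q.2.2‖ ≤ C * ‖q.2.1 - q.2.2‖)
      ⟨0, le_rfl, by simp⟩ ?_ ?_ ?_
    · rintro S T hST ⟨M, h0, h⟩
      exact ⟨M, h0, fun q hq => h q (hST hq)⟩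
    · rintro S T ⟨M, h0, h⟩ ⟨M', h0', h'⟩
      refine ⟨max M M', le_max_of_le_left h0, ?_⟩
      rintro q (hq | hq)
      · exact (h q hq).trans (by gcongr; exact le_max_left _ _)
      · exact (h' q hq).trans (by gcongr; exact le_max_right _ _)
    · rintro ⟨y, x, z⟩ ⟨h1, h2⟩
      by_cases hxz : x = z
      · subst hxz
        obtain ⟨r, hr, C, M, hC, hM, -, hb⟩ := local_lemma hP h1.1
          (notBad_of_omega (lt_of_lt_of_le hs h1.2.2))
        refine ⟨T ∩ (ball y r ×ˢ (ball x r ×ˢ ball x r)), inter_mem self_mem_nhdsWithin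
          (mem_nhdsWithin_of_mem_nhds (prod_mem_nhds (ball_mem_nhds _ hr)
            (prod_mem_nhds (ball_mem_nhds _ hr) (ball_mem_nhds _ hr)))),
          C, hC, ?_⟩
        rintro ⟨w, a, b⟩ ⟨hq, hw, ha, hb'⟩
        exact hb w hw a ⟨hq.1.1, ha⟩ b ⟨hq.2.1, hb'⟩
      · have hδ : 0 < ‖x - z‖ := norm_pos_iff.2 (sub_ne_zero.2 hxz)
        have hev : ∀ᶠ q : Ys m × Xs d × Xs d in 𝓝 (y, x, z), ‖x - z‖ / 2 < ‖q.2.1 - q.2.2‖ := by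
          have hcont : Continuous fun q : Ys m × Xs d × Xs d => ‖q.2.1 - q.2.2‖ := by fun_prop
          exact hcont.continuousAt.eventually (lt_mem_nhds (half_lt_self hδ))
        refine ⟨T ∩ {q | ‖x - z‖ / 2 < ‖q.2.1 - q.2.2‖}, inter_mem self_mem_nhdsWithin
          (mem_nhdsWithin_of_mem_nhds hev), 2 * M / (‖x - z‖ / 2), by positivity, ?_⟩
        rintro ⟨w, a, b⟩ ⟨hq, hq2⟩
        have e1 := hM _ hq.1
        have e2 := hM _ hq.2
        have e3 := norm_sub_le (P w a) (P w b)
        have hq2' : ‖x - z‖ / 2 < ‖a - b‖ := hq2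
        have e4 : 2 * M / (‖x - z‖ / 2) * (‖x - z‖ / 2) ≤ 2 * M / (‖x - z‖ / 2) * ‖a - b‖ := by
          gcongr
        rw [div_mul_cancel₀ _ (by positivity)] at e4
        simp only at e1 e2 ⊢
        linarith
  obtain ⟨C, hC, h⟩ := main
  exact ⟨C, hC, fun y x z h1 h2 => h (y, x, z) ⟨h1, h2⟩⟩

lemma tube_mono {R R' s s' : ℝ} (hR : R ≤ R') (hs : s' ≤ s) :
    STube K f R s ⊆ STube K f R' s' := fun _ h => ⟨h.1, h.2.1.trans hR, hs.trans h.2.2⟩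

lemma H1_nonneg (R s : ℝ) : 0 ≤ H1 K f P R s := by
  apply Real.sSup_nonneg
  rintro r ⟨y, x, z, -, -, -, rfl⟩
  positivity

lemma H2_nonneg (R s : ℝ) : 0 ≤ H2 K f P R s := by
  apply Real.sSup_nonneg
  rintro r ⟨y, x, -, rfl⟩
  positivity

lemma H1_mono (hK : IsBounded K) (hP : IsPrioritySelector f P)
    {R R' s s' : ℝ} (hs' : 0 < s') (hR : R ≤ R') (hs : s' ≤ s) :
    H1 K f P R s ≤ H1 K f P R' s' := by
  refine Real.sSup_le ?_ (H1_nonneg _ _)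
  rintro r ⟨y, x, z, h1, h2, h3, rfl⟩
  refine le_csSup ?_ ⟨y, x, z, tube_mono hR hs h1, tube_mono hR hs h2, h3, rfl⟩
  obtain ⟨C, hC, h⟩ := bound1 hK hP R' hs'
  refine ⟨C, ?_⟩
  rintro r ⟨y, x, z, h1, h2, h3, rfl⟩
  exact div_le_of_le_mul₀ (norm_nonneg _) hC (h y x z h1 h2)

lemma H2_mono (hK : IsBounded K) (hP : IsPrioritySelector f P)
    {R R' s s' : ℝ} (hs' : 0 < s') (hR : R ≤ R') (hs : s' ≤ s) :
    H2 K f P R s ≤ H2 K f P R' s' := by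
  refine Real.sSup_le ?_ (H2_nonneg _ _)
  rintro r ⟨y, x, h1, rfl⟩
  refine le_csSup ?_ ⟨y, x, tube_mono hR hs h1, rfl⟩
  obtain ⟨C, hC, h⟩ := bound2 hK hP R' hs'
  refine ⟨C, ?_⟩
  rintro r ⟨y, x, h1, hr⟩
  rw [hr]
  exact h (y, x) h1

lemma lam_pos (R s : ℝ) : 0 < lamB K f P R s := by
  have := H1_nonneg (K := K) (f := f) (P := P) R s
  have := H2_nonneg (K := K) (f := f) (P := P) R s
  unfold lamB
  positivity

lemma lam_mono (hK : IsBounded K) (hP : IsPrioritySelector f P)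
    {R R' s s' : ℝ} (hs' : 0 < s') (hR : R ≤ R') (hs : s' ≤ s) :
    lamB K f P R' s' ≤ lamB K f P R s := by
  have := H1_nonneg (K := K) (f := f) (P := P) R s
  have := H2_nonneg (K := K) (f := f) (P := P) R s
  have := H1_mono hK hP hs' hR hs
  have := H2_mono hK hP hs' hR hs
  unfold lamB
  apply one_div_le_one_div_of_le <;> linarith

lemma lam_int (hK : IsBounded K) (hP : IsPrioritySelector f P)
    (R : ℝ) {a b : ℝ} (ha : 0 ≤ a) (hb : 0 ≤ b) :
    IntervalIntegrable (fun s => lamB K f P R s) volume a b := by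
  have hm : Monotone fun s : ℝ => if 0 < s then lamB K f P R s else 0 := by
    intro s t hst
    dsimp only
    split_ifs with h1 h2 h2
    · exact lam_mono hK hP h1 le_rfl hst
    · exact absurd (h1.trans_le hst) h2
    · exact (lam_pos _ _).le
    · exact le_rfl
  refine (hm.intervalIntegrable (μ := volume) (a := a) (b := b)).congr ?_
  intro s hs
  have : 0 < s := (le_min ha hb).trans_lt hs.1
  simp [this]

lemma theta_nonneg (R : ℝ) {r : ℝ} (hr : 0 ≤ r) : 0 ≤ ThetaB K f P R r :=
  intervalIntegral.integral_nonneg hr fun _ _ => (lam_pos _ _).le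

lemma theta_lower (hK : IsBounded K) (hP : IsPrioritySelector f P)
    {R R' r c : ℝ} (hc : 0 < c) (hR : R ≤ R') (hr : c ≤ r) :
    c / 2 * lamB K f P R' (c / 2) ≤ ThetaB K f P R r := by
  have h0 : 0 ≤ c / 2 := by positivity
  have h1 : c / 2 ≤ r := by linarith
  unfold ThetaB
  rw [← intervalIntegral.integral_add_adjacent_intervals (lam_int hK hP R le_rfl h0)
    (lam_int hK hP R h0 (h0.trans h1))]
  have e1 : 0 ≤ ∫ s in (0:ℝ)..(c/2), lamB K f P R s := theta_nonneg R h0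
  have e2 : ∫ s in (c/2)..r, lamB K f P R' (c / 2) ≤ ∫ s in (c/2)..r, lamB K f P R s := by
    refine intervalIntegral.integral_mono_on h1 (by simp) (lam_int hK hP R h0 (h0.trans h1)) ?_
    intro s hs
    exact lam_mono hK hP (by positivity) hR hs.1
  rw [intervalIntegral.integral_const, smul_eq_mul] at e2
  have e3 : c / 2 * lamB K f P R' (c / 2) ≤ (r - c / 2) * lamB K f P R' (c / 2) := by
    have := (lam_pos (K := K) (f := f) (P := P) R' (c / 2)).le
    gcongr
    linarith
  linarith

lemma eta_nonneg (y : Ys m) (x : Xs d) : 0 ≤ etaB K f P y x := by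
  have := theta_nonneg (K := K) (f := f) (P := P) (1 + ‖y‖) (omega_nonneg (K := K) (f := f) y x)
  unfold etaB
  positivity

lemma eta_le_one (y : Ys m) (x : Xs d) : etaB K f P y x ≤ 1 := by
  have := theta_nonneg (K := K) (f := f) (P := P) (1 + ‖y‖) (omega_nonneg (K := K) (f := f) y x)
  unfold etaB
  rw [div_le_one (by positivity)]
  linarith

end tube

lemma omega_pos {K : Set (Xs d)} {f : Fin n → Xs d → Ys m} (hne : (BadSet K f).Nonempty)
    {y : Ys m} {x : Xs d} (h1 : ptYX y x ∉ BadSet K f) : 0 < omegaB K f y x := by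
  have h2 : 0 < rhoB K f y x := by
    unfold rhoB
    exact ((Bad_closed K f).notMem_iff_infDist_pos hne).1 h1
  unfold omegaB
  positivity

lemma omega_cont' {K : Set (Xs d)} {f : Fin n → Xs d → Ys m} {x : Xs d} {Y : ℝ → Ys m}
    (hY : Continuous Y) : Continuous fun c => omegaB K f (Y c) x := by
  have h : Continuous fun c => (Y c, x) := hY.prodMk continuous_const
  have h2 := (omega_cont (K := K) (f := f)).comp h
  simp only [Function.comp_def] at h2
  exact h2

lemma iter_tendsto {K : Set (Xs d)} {f : Fin n → Xs d → Ys m} {P : Ys m → Xs d → Ys m}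
    (hK : IsBounded K) (hf : ∀ i, LocLipOn K (f i)) (hext : IsLimitExtension K f)
    (hP : IsPrioritySelector f P) (hne : (BadSet K f).Nonempty)
    {x : Xs d} (hx : x ∈ K \ Unstable K f) {y0 : Ys m} (hy : y0 ∉ Sigma0 f x) :
    Tendsto (fun t : ℕ => (fun y => gB K f P y x)^[t] y0) atTop (𝓝 (P y0 x)) := by
  obtain ⟨p, hp⟩ : ∃ p, p = P y0 x := ⟨_, rfl⟩
  rw [← hp]
  obtain ⟨i0, hi0, hmin, -⟩ := hP y0 x
  have strict : ∀ k, f k x ≠ p → ‖y0 - p‖ < ‖y0 - f k x‖ := by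
    intro k hk
    rw [hp, hi0] at hk ⊢
    refine lt_of_le_of_ne (hmin k) fun he => hy ⟨i0, k, hk.symm, he, hmin⟩
  set Y : ℝ → Ys m := fun c => p + c • (y0 - p) with hY
  have minY : ∀ c ∈ Icc (0:ℝ) 1, ∀ k, (∀ j, ‖Y c - f k x‖ ≤ ‖Y c - f j x‖) → f k x = p := by
    intro c hc k hk
    by_contra hkp
    have h1 := strict k hkp
    have h2 := hk i0
    rw [← hi0, ← hp] at h2
    have e1 : Y c - p = c • (y0 - p) := by simp [hY]
    have e2 : y0 - f k x = (Y c - f k x) + (1 - c) • (y0 - p) := by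
      simp only [hY, sub_smul, one_smul]; abel
    have h3 : ‖y0 - f k x‖ ≤ ‖Y c - f k x‖ + (1 - c) * ‖y0 - p‖ := by
      rw [e2]
      refine (norm_add_le _ _).trans ?_
      rw [norm_smul, Real.norm_of_nonneg (sub_nonneg.2 hc.2)]
    have h4 : ‖Y c - p‖ = c * ‖y0 - p‖ := by
      rw [e1, norm_smul, Real.norm_of_nonneg hc.1]
    linarith
  have PY : ∀ c ∈ Icc (0:ℝ) 1, P (Y c) x = p := by
    intro c hc
    obtain ⟨k, hk, hk2, -⟩ := hP (Y c) x
    rw [hk]; exact minY c hc k hk2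
  have SY : ∀ c ∈ Icc (0:ℝ) 1, Y c ∉ Sigma0 f x := by
    rintro c hc ⟨i, j, hij, he, hi⟩
    exact hij ((minY c hc i hi).trans (minY c hc j (fun k => he ▸ hi k)).symm)
  have Ycont : Continuous Y := by fun_prop
  have posY : ∀ c ∈ Icc (0:ℝ) 1, 0 < omegaB K f (Y c) x := by
    intro c hc
    exact omega_pos hne (notBad hf hext hx (SY c hc))
  have ocont : Continuous fun c => omegaB K f (Y c) x :=
    omega_cont' Ycont
  obtain ⟨cm, hcm, hcmin⟩ := (isCompact_Icc (a := (0:ℝ)) (b := 1)).exists_isMinOn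
    ⟨0, by simp⟩ ocont.continuousOn
  obtain ⟨c0, hc0⟩ : ∃ v, v = omegaB K f (Y cm) x := ⟨_, rfl⟩
  have hc0pos : 0 < c0 := hc0 ▸ posY cm hcm
  obtain ⟨R', hR'⟩ : ∃ v, v = 1 + (‖p‖ + ‖y0 - p‖) := ⟨_, rfl⟩
  obtain ⟨θ, hθ⟩ : ∃ v, v = c0 / 2 * lamB K f P R' (c0 / 2) := ⟨_, rfl⟩
  have hθ0 : 0 < θ := hθ ▸ mul_pos (by positivity) (lam_pos _ _)
  obtain ⟨δ, hδ⟩ : ∃ v, v = θ / (1 + θ) := ⟨_, rfl⟩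
  have hδ0 : 0 < δ := by rw [hδ]; positivity
  have hδ1 : δ < 1 := by rw [hδ, div_lt_one (by positivity)]; linarith
  have etaY : ∀ c ∈ Icc (0:ℝ) 1, δ ≤ etaB K f P (Y c) x := by
    intro c hc
    have h1 : 1 + ‖Y c‖ ≤ R' := by
      have h := norm_add_le p (c • (y0 - p))
      rw [norm_smul, Real.norm_of_nonneg hc.1] at h
      have h' : c * ‖y0 - p‖ ≤ 1 * ‖y0 - p‖ := by
        gcongr
        exact hc.2
      have : ‖Y c‖ = ‖p + c • (y0 - p)‖ := rfl
      linarith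
    have h2 : c0 ≤ omegaB K f (Y c) x := by
      rw [hc0]
      exact isMinOn_iff.1 hcmin c hc
    have h3 : θ ≤ ThetaB K f P (1 + ‖Y c‖) (omegaB K f (Y c) x) := by
      rw [hθ]
      exact theta_lower hK hP hc0pos h1 h2
    unfold etaB
    rw [hδ, div_le_div_iff₀ (by positivity) (by linarith)]
    nlinarith
  have step : ∀ t : ℕ, ∃ c ∈ Icc (0:ℝ) 1, c ≤ (1 - δ) ^ t ∧
      (fun y => gB K f P y x)^[t] y0 = Y c := by
    intro t
    induction t with
    | zero => exact ⟨1, by simp, by simp, by simp [hY]⟩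
    | succ t ih =>
      obtain ⟨c, hc, hct, he⟩ := ih
      rw [Function.iterate_succ_apply', he]
      have h1 := etaY c hc
      have h2 := eta_le_one (K := K) (f := f) (P := P) (Y c) x
      have hc0' := hc.1
      refine ⟨(1 - etaB K f P (Y c) x) * c, ⟨mul_nonneg (by linarith) hc.1, ?_⟩, ?_, ?_⟩
      · exact mul_le_one₀ (by linarith) hc.1 hc.2
      · rw [pow_succ, mul_comm]
        exact mul_le_mul hct (by linarith) (by linarith) (hc0'.trans hct)
      · unfold gB
        rw [PY c hc]
        simp only [hY, smul_add, sub_smul, one_smul, mul_smul]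
        abel
  rw [tendsto_iff_norm_sub_tendsto_zero]
  have hlim : Tendsto (fun t : ℕ => (1 - δ) ^ t * ‖y0 - p‖) atTop (𝓝 0) := by
    have := (tendsto_pow_atTop_nhds_zero_of_lt_one (r := 1 - δ) (by linarith)
      (by linarith)).mul_const ‖y0 - p‖
    simpa using this
  refine squeeze_zero (fun _ => norm_nonneg _) (fun t => ?_) hlim
  obtain ⟨c, hc, hct, he⟩ := step t
  rw [he]
  simp only [hY, add_sub_cancel_left]
  rw [norm_smul, Real.norm_of_nonneg hc.1]
  gcongr

lemma iter_empty {K : Set (Xs d)} {f : Fin n → Xs d → Ys m} {P : Ys m → Xs d → Ys m}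
    (hne : ¬ (BadSet K f).Nonempty) (x : Xs d) (y0 : Ys m) (t : ℕ) :
    (fun y => gB K f P y x)^[t] y0 = y0 := by
  have hB : BadSet K f = ∅ := not_nonempty_iff_eq_empty.1 hne
  have hg : (fun y => gB K f P y x) = id := by
    funext y
    simp [gB, etaB, ThetaB, omegaB, rhoB, hB]
  rw [hg]; simp

lemma null_part {K : Set (Xs d)} (hKmeas : MeasurableSet K)
    {f : Fin n → Xs d → Ys m} (hf : ∀ i, LocLipOn K (f i)) :
    ∀ᵐ y : Ys m, volume {x | x ∈ K ∧ y ∈ Sigma0 f x} = 0 := by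
  classical
  set F : Fin n → Xs d → Ys m := fun i => K.piecewise (f i) 0 with hF
  have hFm : ∀ i, Measurable (F i) := fun i =>
    (contOn hf i).measurable_piecewise continuousOn_const hKmeas
  set G : Set (Xs d × Ys m) := {q | q.1 ∈ K ∧ q.2 ∈ Sigma0 F q.1} with hG
  have hGm : MeasurableSet G := by
    refine (measurable_fst hKmeas).inter ?_
    have : {q : Xs d × Ys m | q.2 ∈ Sigma0 F q.1} = ⋃ i, ⋃ j,
        ({q | F i q.1 = F j q.1}ᶜ ∩ ({q | ‖q.2 - F i q.1‖ = ‖q.2 - F j q.1‖} ∩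
          ⋂ k, {q | ‖q.2 - F i q.1‖ ≤ ‖q.2 - F k q.1‖})) := by
      ext q
      simp [Sigma0]
    change MeasurableSet {q : Xs d × Ys m | q.2 ∈ Sigma0 F q.1}
    rw [this]
    have hn : ∀ i, Measurable fun q : Xs d × Ys m => ‖q.2 - F i q.1‖ := fun i =>
      (measurable_snd.sub ((hFm i).comp measurable_fst)).norm
    refine MeasurableSet.iUnion fun i => MeasurableSet.iUnion fun j => ?_
    refine (measurableSet_eq_fun ((hFm i).comp measurable_fst)
      ((hFm j).comp measurable_fst)).compl.inter ?_
    refine (measurableSet_eq_fun (hn i) (hn j)).inter ?_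
    exact MeasurableSet.iInter fun k => measurableSet_le (hn i) (hn k)
  have hsec : ∀ x, volume (Prod.mk x ⁻¹' G) = 0 := by
    intro x
    have hsub : Prod.mk x ⁻¹' G ⊆ ⋃ i, ⋃ j : {j // F i x ≠ F j x},
        (AffineSubspace.perpBisector (F i x) (F j x) : Set (Ys m)) := by
      rintro y ⟨-, i, j, hij, he, -⟩
      refine mem_iUnion.2 ⟨i, mem_iUnion.2 ⟨⟨j, hij⟩, ?_⟩⟩
      rw [SetLike.mem_coe, AffineSubspace.mem_perpBisector_iff_dist_eq, dist_eq_norm, dist_eq_norm]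
      exact he
    refine measure_mono_null hsub ?_
    refine measure_iUnion_null fun i => measure_iUnion_null fun j => ?_
    exact Measure.addHaar_affineSubspace _ _ (fun h => j.2 (AffineSubspace.perpBisector_eq_top.1 h))
  have hG0 : ((volume : Measure (Xs d)).prod (volume : Measure (Ys m))) G = 0 :=
    (Measure.measure_prod_null hGm).2 (Eventually.of_forall hsec)
  have hG1 : ((volume : Measure (Ys m)).prod (volume : Measure (Xs d))) (Prod.swap ⁻¹' G) = 0 := by
    rw [Measure.measurePreserving_swap.measure_preimage hGm.nullMeasurableSet, hG0]
  filter_upwards [Measure.measure_ae_null_of_prod_null hG1] with y hy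
  refine measure_mono_null ?_ hy
  rintro x ⟨hxK, hx⟩
  refine ⟨hxK, ?_⟩
  have hFf : ∀ i, F i x = f i x := fun i => by simp [hF, hxK]
  simpa [Sigma0, hFf] using hx

/-- For almost every initialization `y₀`, the fixed-initialization
switching set `N(y₀)` is Lebesgue null; the limit `u(y₀, x)` of the iteration of the
constructed operator `g` exists for every `x ∈ K* \ N(y₀)`; and `x ↦ u(y₀, x)` is
locally Lipschitz on `K* \ N(y₀)`. -/
theorem statement1 {d m n : ℕ}
    (K : Set (Xs d)) (hK : IsBounded K) (hKmeas : MeasurableSet K)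
    (f : Fin n → Xs d → Ys m) (hf : ∀ i, LocLipOn K (f i))
    (hext : IsLimitExtension K f)
    (P : Ys m → Xs d → Ys m) (hP : IsPrioritySelector f P) :
    ∃ E : Set (Ys m), volume E = 0 ∧
      ∀ y0 : Ys m, y0 ∉ E →
        -- (i) the switching set N(y₀) ⊆ K* is Lebesgue null
        volume {x | x ∈ K \ Unstable K f ∧ y0 ∈ Sigma0 f x} = 0 ∧
        -- (ii) the limit u(y₀, x) exists for x ∈ K* \ N(y₀)
        (∀ x ∈ (K \ Unstable K f) \ {x | y0 ∈ Sigma0 f x},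
          ∃ L : Ys m,
            Tendsto (fun t : ℕ => (fun y => gB K f P y x)^[t] y0) atTop (𝓝 L)) ∧
        -- (iii) x ↦ u(y₀, x) is locally Lipschitz on K* \ N(y₀)
        LocLipOn ((K \ Unstable K f) \ {x | y0 ∈ Sigma0 f x})
          (fun x => limUnder atTop (fun t : ℕ => (fun y => gB K f P y x)^[t] y0)) := by
  refine ⟨{y | ¬ volume {x | x ∈ K ∧ y ∈ Sigma0 f x} = 0}, null_part hKmeas hf, ?_⟩
  intro y0 hy0
  have hy0' : volume {x | x ∈ K ∧ y0 ∈ Sigma0 f x} = 0 := not_not.1 hy0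
  have hsub : {x | x ∈ K \ Unstable K f ∧ y0 ∈ Sigma0 f x} ⊆ {x | x ∈ K ∧ y0 ∈ Sigma0 f x} := by
    rintro x ⟨h1, h2⟩
    exact ⟨h1.1, h2⟩
  refine ⟨measure_mono_null hsub hy0', ?_⟩
  by_cases hne : (BadSet K f).Nonempty
  · refine ⟨fun x hx => ⟨_, iter_tendsto hK hf hext hP hne hx.1 hx.2⟩, ?_⟩
    intro x hx
    obtain ⟨r, hr, C, M, hC, hM, -, hb⟩ := local_lemma hP (subset_closure hx.1.1)
      (notBad hf hext hx.1 hx.2)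
    refine ⟨C.toNNReal, ((K \ Unstable K f) \ {x | y0 ∈ Sigma0 f x}) ∩ ball x r,
      inter_mem self_mem_nhdsWithin (mem_nhdsWithin_of_mem_nhds (ball_mem_nhds _ hr)), ?_⟩
    refine LipschitzOnWith.of_dist_le_mul ?_
    intro a ha b hb'
    rw [(iter_tendsto hK hf hext hP hne ha.1.1 ha.1.2).limUnder_eq,
      (iter_tendsto hK hf hext hP hne hb'.1.1 hb'.1.2).limUnder_eq,
      dist_eq_norm, dist_eq_norm, Real.coe_toNNReal _ hC]
    exact hb y0 (mem_ball_self hr) a ⟨subset_closure ha.1.1.1, ha.2⟩ b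
      ⟨subset_closure hb'.1.1.1, hb'.2⟩
  · have ht : ∀ x, Tendsto (fun t : ℕ => (fun y => gB K f P y x)^[t] y0) atTop (𝓝 y0) := by
      intro x
      simp only [iter_empty hne]
      exact tendsto_const_nhds
    refine ⟨fun x _ => ⟨y0, ht x⟩, ?_⟩
    intro x hx
    refine ⟨0, univ, univ_mem, ?_⟩
    refine LipschitzOnWith.of_dist_le_mul ?_
    intro a _ b _
    rw [(ht a).limUnder_eq, (ht b).limUnder_eq]
    simp

end Bif
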